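/- Let g : ℝ² \ {0} → ℝ be (real-)analytic and let f(u) = g(u)·(−u₂, u₁). Suppose the explicit midpoint method conserves the norm for all step sizes: for every u₀ ∈ ℝ² \ {0} and every Δt > 0 such that y₂ = u₀ + (Δt/2) f(u₀) ≠ 0, the update u₊ = u₀ + Δt f(y₂) satisfies ‖u₊‖ = ‖u₀‖. Then there exists c ∈ ℝ such that g(u) = c / ‖u‖² for all u ∈ ℝ² \ {0}, i.e. g is a scalar multiple of u ↦ ‖u‖^{−2}. -/

import Mathlib

/-- The point `u + s J u`, where `J` is the rotation by a right angle. -/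
noncomputable def tangentPoint (u : EuclideanSpace ℝ (Fin 2)) (s : ℝ) :
    EuclideanSpace ℝ (Fin 2) :=
  !₂[u 0 - s * u 1, u 1 + s * u 0]

@[simp] theorem tangentPoint_apply_zero (u : EuclideanSpace ℝ (Fin 2)) (s : ℝ) :
    tangentPoint u s 0 = u 0 - s * u 1 := rfl

@[simp] theorem tangentPoint_apply_one (u : EuclideanSpace ℝ (Fin 2)) (s : ℝ) :
    tangentPoint u s 1 = u 1 + s * u 0 := rfl

theorem continuous_tangentPoint (u : EuclideanSpace ℝ (Fin 2)) :
    Continuous (tangentPoint u) := by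
  refine (PiLp.continuous_toLp 2 _).comp (continuous_pi fun i => ?_)
  fin_cases i <;> simp <;> fun_prop

theorem sq_add_sq_pos_of_ne_zero {u : EuclideanSpace ℝ (Fin 2)} (hu : u ≠ 0) :
    0 < u 0 ^ 2 + u 1 ^ 2 := by
  have h := EuclideanSpace.real_norm_sq_eq u
  rw [Fin.sum_univ_two] at h
  rw [← h]
  exact pow_pos (norm_pos_iff.mpr hu) 2

theorem tangentPoint_ne_zero {u : EuclideanSpace ℝ (Fin 2)} (hu : u ≠ 0) (s : ℝ) :
    tangentPoint u s ≠ 0 := by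
  intro h
  have h0 : u 0 - s * u 1 = 0 := by simpa using congrArg (fun v => v 0) h
  have h1 : u 1 + s * u 0 = 0 := by simpa using congrArg (fun v => v 1) h
  refine (sq_add_sq_pos_of_ne_zero hu).ne' ?_
  linear_combination u 0 * h0 + u 1 * h1

/-- A continuous `G` taking only the values `0` and `G u` on a tangent ray from `u`
is constant on this ray. -/
theorem eq_of_mem_tangent_ray {G : EuclideanSpace ℝ (Fin 2) → ℝ}
    (hG : ∀ u, u ≠ 0 → ContinuousAt G u) {u : EuclideanSpace ℝ (Fin 2)} (hu : u ≠ 0) {σ : ℝ}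
    (hray : ∀ τ, 0 < τ → G (tangentPoint u (τ * σ)) = 0 ∨ G (tangentPoint u (τ * σ)) = G u)
    {τ : ℝ} (hτ : 0 ≤ τ) : G (tangentPoint u (τ * σ)) = G u := by
  have hzero : tangentPoint u (0 * σ) = u := by
    ext i; fin_cases i <;> simp [tangentPoint]
  have hcont : ContinuousOn (fun τ : ℝ => G (tangentPoint u (τ * σ))) (Set.Ici 0) := by
    intro τ _
    refine ContinuousAt.continuousWithinAt ?_
    refine ContinuousAt.comp (f := fun τ : ℝ => tangentPoint u (τ * σ))
      (hG _ (tangentPoint_ne_zero hu _)) ?_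
    exact ((continuous_tangentPoint u).comp (continuous_id.mul continuous_const)).continuousAt
  have hmaps : Set.MapsTo (fun τ : ℝ => G (tangentPoint u (τ * σ))) (Set.Ici 0) {0, G u} := by
    intro τ hτ
    rcases eq_or_lt_of_le (Set.mem_Ici.mp hτ) with h | h
    · right; simp only [← h, hzero]; rfl
    · exact hray τ h
  have hfin : ({0, G u} : Set ℝ).Finite := by simp
  have := isPreconnected_Ici.constant_of_mapsTo (S := Set.Ici (0 : ℝ)) hfin.isDiscrete hcont hmaps
    hτ (Set.mem_Ici.mpr le_rfl)
  simpa only [hzero] using this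

/-- Every point near `u (1 + i σ) (1 + 2 i σ)` is reached from `u` by two tangential moves
in the direction `σ`. -/
theorem exists_eventually_eq_tangentPoint_tangentPoint {u : EuclideanSpace ℝ (Fin 2)}
    (hu : u ≠ 0) {σ : ℝ} (hσ : σ ^ 2 = 1) :
    ∀ᶠ v in nhds (tangentPoint (tangentPoint u σ) (2 * σ)),
      ∃ s t : ℝ, 0 ≤ s ∧ 0 ≤ t ∧ v = tangentPoint (tangentPoint u (s * σ)) (t * σ) := by
  have hpos := sq_add_sq_pos_of_ne_zero hu
  set r := u 0 ^ 2 + u 1 ^ 2 with hr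
  set x : EuclideanSpace ℝ (Fin 2) → ℝ := fun v => (u 0 * v 0 + u 1 * v 1) / r with hx
  set y : EuclideanSpace ℝ (Fin 2) → ℝ := fun v => σ * (u 0 * v 1 - u 1 * v 0) / r with hy
  set w := tangentPoint (tangentPoint u σ) (2 * σ) with hw
  have hxc : Continuous x := by fun_prop
  have hyc : Continuous y := by fun_prop
  have hxw : x w = -1 := by
    simp only [hx, hw, tangentPoint_apply_zero, tangentPoint_apply_one]
    rw [div_eq_iff hpos.ne']
    linear_combination (-2 * r) * hσ
  have hyw : y w = 3 := by
    simp only [hy, hw, tangentPoint_apply_zero, tangentPoint_apply_one]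
    rw [div_eq_iff hpos.ne']
    linear_combination (3 * r) * hσ
  have h1 : ∀ᶠ v in nhds w, x v < 1 :=
    hxc.continuousAt.eventually_lt continuousAt_const (by rw [hxw]; norm_num)
  have h2 : ∀ᶠ v in nhds w, 0 < y v :=
    continuousAt_const.eventually_lt hyc.continuousAt (by rw [hyw]; norm_num)
  have h3 : ∀ᶠ v in nhds w, 0 < y v ^ 2 - 4 + 4 * x v :=
    continuousAt_const.eventually_lt (by fun_prop) (by rw [hxw, hyw]; norm_num)
  filter_upwards [h1, h2, h3] with v h1 h2 h3
  set d := √(y v ^ 2 - 4 + 4 * x v) with hd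
  have hdsq : d ^ 2 = y v ^ 2 - 4 + 4 * x v := Real.sq_sqrt h3.le
  have hd0 : 0 ≤ d := Real.sqrt_nonneg _
  have hdy : d ≤ y v := abs_le_of_sq_le_sq' (by linarith) h2.le |>.2
  have hxr : x v * r = u 0 * v 0 + u 1 * v 1 := div_mul_cancel₀ _ hpos.ne'
  have hyr : y v * r = σ * (u 0 * v 1 - u 1 * v 0) := div_mul_cancel₀ _ hpos.ne'
  have hv0 : v 0 = u 0 * x v - σ * u 1 * y v := by
    apply mul_right_cancel₀ hpos.ne'
    linear_combination (-u 0) * hxr + σ * u 1 * hyr + u 1 * (u 0 * v 1 - u 1 * v 0) * hσ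
  have hv1 : v 1 = u 1 * x v + σ * u 0 * y v := by
    apply mul_right_cancel₀ hpos.ne'
    linear_combination (-u 1) * hxr - σ * u 0 * hyr - u 0 * (u 0 * v 1 - u 1 * v 0) * hσ
  refine ⟨(y v + d) / 2, (y v - d) / 2, by linarith, by linarith, ?_⟩
  ext i
  fin_cases i
  · simp only [Fin.zero_eta, tangentPoint_apply_zero, tangentPoint_apply_one]
    linear_combination hv0 + u 0 * (y v ^ 2 - d ^ 2) / 4 * hσ - u 0 / 4 * hdsq
  · simp only [Fin.mk_one, tangentPoint_apply_zero, tangentPoint_apply_one]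
    linear_combination hv1 + u 1 * (y v ^ 2 - d ^ 2) / 4 * hσ - u 1 / 4 * hdsq

/-- Theorem 5.3(b): if `g : ℝ² \ {0} → ℝ` is real-analytic and the explicit midpoint
method conserves the Euclidean norm for `f(u) = g(u)(-u₂, u₁)` for every nonzero initial
value and every positive step size (whenever the stage is nonzero), then `g` is a scalar
multiple of `u ↦ ‖u‖⁻²`. -/
theorem norm_conserving_problem_is_unique
    (g : EuclideanSpace ℝ (Fin 2) → ℝ)
    (hg : ∀ u : EuclideanSpace ℝ (Fin 2), u ≠ 0 → AnalyticAt ℝ g u)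
    (f : EuclideanSpace ℝ (Fin 2) → EuclideanSpace ℝ (Fin 2))
    (hf : ∀ u : EuclideanSpace ℝ (Fin 2), f u = g u • ![-(u 1), u 0])
    (hconserve : ∀ u₀ : EuclideanSpace ℝ (Fin 2), u₀ ≠ 0 → ∀ Δt : ℝ, 0 < Δt →
      u₀ + (Δt / 2) • f u₀ ≠ 0 →
      ‖u₀ + Δt • f (u₀ + (Δt / 2) • f u₀)‖ = ‖u₀‖) :
    ∃ c : ℝ, ∀ u : EuclideanSpace ℝ (Fin 2), u ≠ 0 → g u = c / ‖u‖ ^ 2 := by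
  have hf0 : ∀ u, f u 0 = -(g u * u 1) := fun u => by
    simpa using congrFun (hf u) 0
  have hf1 : ∀ u, f u 1 = g u * u 0 := fun u => by
    simpa using congrFun (hf u) 1
  have hstep : ∀ u (h : ℝ), u + h • f u = tangentPoint u (h * g u) := fun u h => by
    ext i
    fin_cases i
    · simp [hf0]; ring
    · simp [hf1]; ring
  have hnorm : ∀ v : EuclideanSpace ℝ (Fin 2), ‖v‖ ^ 2 = v 0 ^ 2 + v 1 ^ 2 := fun v => by
    rw [EuclideanSpace.real_norm_sq_eq, Fin.sum_univ_two]
  set G : EuclideanSpace ℝ (Fin 2) → ℝ := fun v => g v * (v 0 ^ 2 + v 1 ^ 2) with hGdef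
  have hGan : ∀ v, v ≠ 0 → AnalyticAt ℝ G v := fun v hv => by
    have hc : ∀ i, AnalyticAt ℝ (fun v : EuclideanSpace ℝ (Fin 2) => v i) v := fun i =>
      (EuclideanSpace.proj (𝕜 := ℝ) i : EuclideanSpace ℝ (Fin 2) →L[ℝ] ℝ).analyticAt v
    exact (hg v hv).mul (((hc 0).pow 2).add ((hc 1).pow 2))
  have hdich : ∀ u, u ≠ 0 → ∀ h : ℝ, 0 < h →
      G (tangentPoint u (h * g u)) = 0 ∨ G (tangentPoint u (h * g u)) = G u := by
    intro u hu h hh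
    have hc := hconserve u hu (2 * h) (by positivity)
    rw [mul_div_cancel_left₀ h two_ne_zero, hstep] at hc
    have hsq := congrArg (· ^ 2) (hc (tangentPoint_ne_zero hu _))
    simp only [hnorm, PiLp.add_apply, PiLp.smul_apply, smul_eq_mul, hf0, hf1] at hsq
    set v := tangentPoint u (h * g u) with hv
    have hv0 : v 0 = u 0 - h * g u * u 1 := rfl
    have hv1 : v 1 = u 1 + h * g u * u 0 := rfl
    have hprod : h ^ 2 * (g v * (G v - G u)) = 0 := by
      simp only [hGdef]
      rw [hv0, hv1] at hsq ⊢
      linear_combination hsq / 4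
    rcases mul_eq_zero.mp ((mul_eq_zero.mp hprod).resolve_left (by positivity)) with h0 | h0
    · left; simp [hGdef, h0]
    · right; linarith
  have hGg : ∀ u, u ≠ 0 → g u = G u / ‖u‖ ^ 2 := fun u hu => by
    rw [hnorm, eq_div_iff (sq_add_sq_pos_of_ne_zero hu).ne']
  by_cases hz : ∀ u, u ≠ 0 → g u = 0
  · exact ⟨0, fun u hu => by simp [hz u hu]⟩
  push Not at hz
  obtain ⟨u, hu, hgu⟩ := hz
  obtain ⟨σ, hσ, hσg⟩ : ∃ σ : ℝ, σ ^ 2 = 1 ∧ 0 < σ * g u := by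
    rcases lt_or_gt_of_ne hgu with h | h
    · exact ⟨-1, by norm_num, by linarith⟩
    · exact ⟨1, by norm_num, by linarith⟩
  have hmove : ∀ v, v ≠ 0 → 0 < σ * g v → ∀ s, 0 ≤ s → G (tangentPoint v (s * σ)) = G v := by
    intro v hv hσv s hs
    refine eq_of_mem_tangent_ray (fun w hw => (hGan w hw).continuousAt) hv (fun τ hτ => ?_) hs
    have := hdich v hv (τ / (σ * g v)) (by positivity)
    have hg0 : g v ≠ 0 := right_ne_zero_of_mul hσv.ne'
    have hσ0 : σ ≠ 0 := left_ne_zero_of_mul hσv.ne'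
    rwa [show τ / (σ * g v) * g v = τ * σ by field_simp; exact hσ.symm] at this
  have hconst : ∀ᶠ v in nhds (tangentPoint (tangentPoint u σ) (2 * σ)), G v = G u := by
    filter_upwards [exists_eventually_eq_tangentPoint_tangentPoint hu hσ]
    rintro v ⟨s, t, hs, ht, rfl⟩
    have h1 := hmove u hu hσg s hs
    have hne := tangentPoint_ne_zero hu (s * σ)
    have hp := sq_add_sq_pos_of_ne_zero hne
    have hp' := sq_add_sq_pos_of_ne_zero hu
    have hpos : 0 < σ * g (tangentPoint u (s * σ)) := by
      rw [hGg _ hne, h1, hnorm, mul_div_assoc']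
      refine div_pos ?_ hp
      simp only [hGdef, ← mul_assoc]
      exact mul_pos hσg hp'
    rw [hmove _ hne hpos t ht, h1]
  have hconn : IsPreconnected ({0}ᶜ : Set (EuclideanSpace ℝ (Fin 2))) := by
    refine (isConnected_compl_singleton_of_one_lt_rank ?_ 0).isPreconnected
    rw [← Module.finrank_eq_rank]
    simp
  have hall := AnalyticOnNhd.eqOn_of_preconnected_of_eventuallyEq (f := G) (g := fun _ => G u)
    (fun v hv => hGan v hv) (fun v _ => analyticAt_const) hconn
    (tangentPoint_ne_zero (tangentPoint_ne_zero hu σ) (2 * σ)) hconst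
  exact ⟨G u, fun v hv => by rw [hGg v hv, hall hv]⟩
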